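/- arXiv:2403.17364 — 4 statements merged into one kernel-verified Lean document; each statement's English description precedes it below -/
import Mathlib

section
/- Let E be a real finite-dimensional inner product space, let f : E → ℝ be differentiable, let μ > 0, and suppose f attains its infimum at some x* ∈ E and satisfies the PL inequality f(x) − f(x*) ≤ (μ/2)‖∇f(x)‖² for all x ∈ E. Let λ > 0, let x ∈ E, and let p ∈ E be a minimizer over E of y ↦ f(y) + (λ/2)‖y − x‖². Then f(p) + (λ/2)‖p − x‖² − f(x*) ≤ (μ/2 + 1/(2λ)) · ‖λ(x − p)‖². (Equivalently: the Moreau envelope f_λ satisfies the gradient-dominance inequality f_λ(x) − inf f_λ ≤ (μ/2 + 1/(2λ))‖∇f_λ(x)‖², since ∇f_λ(x) = λ(x − p) and inf f_λ = inf f.) -/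
/-- First-order optimality: the gradient at a proximal point `p` of `f` at `x` is `lam • (x - p)`. -/
theorem gradient_eq_smul_sub_of_isMinOn_prox {E : Type*} [NormedAddCommGroup E]
    [InnerProductSpace ℝ E] [CompleteSpace E] {f : E → ℝ} {lam : ℝ} {x p : E}
    (hf : DifferentiableAt ℝ f p)
    (hp : IsMinOn (fun y : E => f y + lam / 2 * ‖y - x‖ ^ 2) Set.univ p) :
    gradient f p = lam • (x - p) := by
  have hderiv := hf.hasGradientAt.hasFDerivAt.add
    ((((hasFDerivAt_id p).sub_const x).norm_sq).const_mul (lam / 2))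
  have hzero := (hp.isLocalMin Filter.univ_mem).hasFDerivAt_eq_zero hderiv
  refine ext_inner_right ℝ fun v => ?_
  have hv := DFunLike.congr_fun hzero v
  simp at hv
  simp only [inner_gradient_left, real_inner_smul_left, inner_sub_left]
  linarith

/-- **Gradient dominance of the Moreau envelope cost** (Lemma 6).
If `f` is differentiable, attains its infimum at `xstar`, and satisfies the PL
inequality with constant `μ`, then for `lam > 0` and any minimizer `p` of the
proximal subproblem at `x`, the Moreau envelope value satisfies a gradient
dominance inequality. -/
theorem stmt_0 {E : Type*} [NormedAddCommGroup E] [InnerProductSpace ℝ E]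
    [FiniteDimensional ℝ E]
    (f : E → ℝ) (hf : Differentiable ℝ f)
    (μ : ℝ) (hμ : 0 < μ)
    (xstar : E) (hmin : ∀ y : E, f xstar ≤ f y)
    (hPL : ∀ x : E, f x - f xstar ≤ μ / 2 * ‖gradient f x‖ ^ 2)
    (lam : ℝ) (hlam : 0 < lam)
    (x p : E)
    (hp : IsMinOn (fun y : E => f y + lam / 2 * ‖y - x‖ ^ 2) Set.univ p) :
    f p + lam / 2 * ‖p - x‖ ^ 2 - f xstar ≤
      (μ / 2 + 1 / (2 * lam)) * ‖lam • (x - p)‖ ^ 2 := by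
  have hgrad := hPL p
  rw [gradient_eq_smul_sub_of_isMinOn_prox (hf p) hp] at hgrad
  have hquad : lam / 2 * ‖p - x‖ ^ 2 = 1 / (2 * lam) * ‖lam • (x - p)‖ ^ 2 := by
    rw [norm_smul, norm_sub_rev, mul_pow, Real.norm_eq_abs, sq_abs]
    field_simp
  rw [hquad, add_mul]
  linarith
end

section
/- Let E be a real finite-dimensional inner product space, let f : E → ℝ be differentiable with L-Lipschitz gradient, let λ > L, and for each x ∈ E let p(x) denote the unique minimizer over E of y ↦ f(y) + (λ/2)‖y − x‖². Then the map G : E → E defined by G(x) := λ(x − p(x)) is Lipschitz with constant λL/(λ − L): for all x₁, x₂ ∈ E, ‖λ(x₁ − p(x₁)) − λ(x₂ − p(x₂))‖ ≤ (λL/(λ − L))‖x₁ − x₂‖. -/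
/-- First-order optimality condition for the proximal point: at a minimizer `q` of
`y ↦ f y + lam / 2 * ‖y - x‖ ^ 2`, the gradient of `f` is `lam • (x - q)`. -/
theorem gradient_eq_smul_sub_of_isMinOn {E : Type*} [NormedAddCommGroup E]
    [InnerProductSpace ℝ E] [CompleteSpace E] {f : E → ℝ} {lam : ℝ} {x q : E}
    (hf : DifferentiableAt ℝ f q)
    (hq : IsMinOn (fun y : E => f y + lam / 2 * ‖y - x‖ ^ 2) Set.univ q) :
    gradient f q = lam • (x - q) := by
  have hsq := (((hasFDerivAt_id q).sub_const x).norm_sq).const_mul (lam / 2)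
  have h0 := (hq.isLocalMin Filter.univ_mem).hasFDerivAt_eq_zero
    (hf.hasGradientAt.hasFDerivAt.add hsq)
  refine ext_inner_right ℝ fun v => ?_
  have hv := DFunLike.congr_fun h0 v
  simp only [add_apply, smul_apply, InnerProductSpace.toDual_apply_apply,
    ContinuousLinearMap.comp_apply, innerSL_apply_apply, ContinuousLinearMap.id_apply,
    zero_apply, smul_eq_mul, nsmul_eq_mul, id_eq, inner_sub_left] at hv
  rw [real_inner_smul_left, inner_sub_left]
  push_cast at hv
  linarith


/-- **Smoothness transfer to the Moreau envelope** (Lemma 7).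
If `f` is differentiable with `L`-Lipschitz gradient, `lam > L`, and `p x` is the unique
proximal point at every `x`, then the Moreau-envelope gradient mapping
`G x = lam • (x - p x)` is Lipschitz with constant `lam * L / (lam - L)`. -/
theorem stmt_5 {E : Type*} [NormedAddCommGroup E] [InnerProductSpace ℝ E]
    [FiniteDimensional ℝ E]
    (f : E → ℝ) (hf : Differentiable ℝ f)
    (L : ℝ)
    (hlip : ∀ x y : E, ‖gradient f x - gradient f y‖ ≤ L * ‖x - y‖)
    (lam : ℝ) (hlam : L < lam)
    (p : E → E)
    (hp : ∀ x : E, IsMinOn (fun y : E => f y + lam / 2 * ‖y - x‖ ^ 2) Set.univ (p x)) :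
    ∀ x₁ x₂ : E,
      ‖lam • (x₁ - p x₁) - lam • (x₂ - p x₂)‖ ≤ (lam * L / (lam - L)) * ‖x₁ - x₂‖ := by
  intro x₁ x₂
  rcases eq_or_ne x₁ x₂ with rfl | hne
  · simp
  have hx : 0 < ‖x₁ - x₂‖ := norm_pos_iff.mpr (sub_ne_zero.mpr hne)
  have hL : 0 ≤ L := nonneg_of_mul_nonneg_left ((norm_nonneg _).trans (hlip x₁ x₂)) hx
  have hlam0 : 0 < lam := hL.trans_lt hlam
  have hG : ‖lam • (x₁ - p x₁) - lam • (x₂ - p x₂)‖ ≤ L * ‖p x₁ - p x₂‖ := by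
    simpa only [gradient_eq_smul_sub_of_isMinOn (hf _) (hp x₁),
      gradient_eq_smul_sub_of_isMinOn (hf _) (hp x₂)] using hlip (p x₁) (p x₂)
  have hP : lam * ‖p x₁ - p x₂‖ ≤
      lam * ‖x₁ - x₂‖ + ‖lam • (x₁ - p x₁) - lam • (x₂ - p x₂)‖ := by
    have hdecomp : lam • (p x₁ - p x₂) =
        lam • (x₁ - x₂) - (lam • (x₁ - p x₁) - lam • (x₂ - p x₂)) := by
      module
    have h := norm_sub_le (lam • (x₁ - x₂)) (lam • (x₁ - p x₁) - lam • (x₂ - p x₂))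
    rwa [← hdecomp, norm_smul_of_nonneg hlam0.le, norm_smul_of_nonneg hlam0.le] at h
  rw [div_mul_eq_mul_div, le_div_iff₀ (sub_pos.mpr hlam)]
  linarith [mul_le_mul_of_nonneg_left hG hlam0.le, mul_le_mul_of_nonneg_left hP hL]
end

section
/- Let E be a real finite-dimensional inner product space, V ≥ 1, P ≥ 1, and let f_i : E → ℝ, i = 1, …, V, each be differentiable with L-Lipschitz gradient; let λ > L and for each i let p_i(x) be the unique minimizer over E of y ↦ f_i(y) + (λ/2)‖y − x‖², with g_i(x) := λ(x − p_i(x)). Set L_λ := λL/(λ − L) (so each g_i is L_λ-Lipschitz). Fix K ∈ E, step sizes α > 0, β > 0, accuracy ε ≥ 0, and set η := αβP. For each i, let K_i^0 := K, and for p = 0, …, P − 1 let K̄_i^p ∈ E satisfy ‖K̄_i^p − p_i(K_i^p)‖ ≤ ε and K_i^{p+1} := K_i^p − αλ(K_i^p − K̄_i^p). If η ≤ β/(2L_λ), then (1/(VP))∑_{i=1}^{V}∑_{p=0}^{P−1} ‖λ(K_i^p − K̄_i^p) − g_i(K)‖² ≤ 2λ²ε² + (16 L_λ² η²/β²)·(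 2λ²ε²/P + 3·(1/V)∑_{i=1}^{V} ‖g_i(K)‖² ). -/
/-- First-order optimality condition of the proximal map. -/
theorem gradient_eq_of_isMinOn_prox {E : Type*} [NormedAddCommGroup E]
    [InnerProductSpace ℝ E] [CompleteSpace E] {f : E → ℝ} {lam : ℝ} {x z : E}
    (hf : DifferentiableAt ℝ f z)
    (hz : IsMinOn (fun y : E => f y + lam / 2 * ‖y - x‖ ^ 2) Set.univ z) :
    gradient f z = lam • (x - z) := by
  have hquad := (((hasFDerivAt_id (𝕜 := ℝ) z).sub_const x).norm_sq).const_mul (lam / 2)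
  have hzero := (hz.isLocalMin Filter.univ_mem).hasFDerivAt_eq_zero
    (hf.hasGradientAt.hasFDerivAt.add hquad)
  refine ext_inner_right ℝ fun v => ?_
  have hv := DFunLike.congr_fun hzero v
  simp at hv
  rw [inner_smul_left, ← neg_sub z x, inner_neg_left, inner_sub_left]
  simp
  linarith

/-- The gradient of the Moreau envelope of an `L`-smooth function is
`lam * L / (lam - L)`-Lipschitz. -/
theorem norm_moreau_gradient_sub_le {E : Type*} [NormedAddCommGroup E]
    [InnerProductSpace ℝ E] [CompleteSpace E] {f : E → ℝ} (hf : Differentiable ℝ f)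
    {L lam : ℝ} (hL : 0 ≤ L) (hlam : L < lam)
    (hlip : ∀ x y : E, ‖gradient f x - gradient f y‖ ≤ L * ‖x - y‖) {p : E → E}
    (hp : ∀ x : E, IsMinOn (fun y : E => f y + lam / 2 * ‖y - x‖ ^ 2) Set.univ (p x))
    (x y : E) :
    ‖lam • (x - p x) - lam • (y - p y)‖ ≤ lam * L / (lam - L) * ‖x - y‖ := by
  have hlam0 : 0 < lam := hL.trans_lt hlam
  have hgap : 0 < lam - L := sub_pos.2 hlam
  have hgrad : ‖lam • (x - p x) - lam • (y - p y)‖ ≤ L * ‖p x - p y‖ := by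
    rw [← gradient_eq_of_isMinOn_prox (hf _) (hp x),
      ← gradient_eq_of_isMinOn_prox (hf _) (hp y)]
    exact hlip _ _
  have hprox : lam * ‖p x - p y‖ ≤ lam * ‖x - y‖ + L * ‖p x - p y‖ := by
    have hsplit : lam • (p x - p y) =
        lam • (x - y) - (lam • (x - p x) - lam • (y - p y)) := by module
    have hnorm := norm_sub_le (lam • (x - y)) (lam • (x - p x) - lam • (y - p y))
    rw [← hsplit, norm_smul, norm_smul, Real.norm_of_nonneg hlam0.le] at hnorm
    linarith
  refine hgrad.trans ?_
  rw [div_mul_eq_mul_div, le_div_iff₀ hgap]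
  nlinarith

theorem one_add_pow_le_of_mul_le_half {u : ℝ} (hu : 0 ≤ u) {q : ℕ} (hqu : q * u ≤ 1 / 2) :
    (1 + u) ^ q ≤ 1 + 3 / 2 * (q * u) := by
  have hx : 0 ≤ q * u := by positivity
  have hpow : (1 + u) ^ q ≤ Real.exp (q * u) := by
    rw [Real.exp_nat_mul]
    gcongr
    linarith [Real.add_one_le_exp u]
  have hexp := (abs_le.1 (Real.abs_exp_sub_one_sub_id_le (x := q * u)
    (by rw [abs_of_nonneg hx]; linarith))).2
  nlinarith

/-- If an iteration follows a perturbation of size `δ` of an `M`-Lipschitz field `g`, then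
its displacement from the starting point grows at most geometrically. -/
theorem mul_norm_sub_le_of_perturbed_step {E : Type*} [NormedAddCommGroup E]
    [NormedSpace ℝ E] {g : E → E} {M α δ : ℝ} (hM : 0 ≤ M) (hα : 0 ≤ α)
    (hg : ∀ x y, ‖g x - g y‖ ≤ M * ‖x - y‖) {x h : ℕ → E} {P : ℕ}
    (hh : ∀ q < P, ‖h q - g (x q)‖ ≤ δ) (hx : ∀ q < P, x (q + 1) = x q - α • h q)
    {q : ℕ} (hq : q ≤ P) :
    M * ‖x q - x 0‖ ≤ (δ + ‖g (x 0)‖) * ((1 + α * M) ^ q - 1) := by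
  induction q with
  | zero => simp
  | succ q ih =>
    have hqP : q < P := hq
    have hfield : ‖h q‖ ≤ δ + M * ‖x q - x 0‖ + ‖g (x 0)‖ := by
      have hsplit : h q = (h q - g (x q)) + (g (x q) - g (x 0)) + g (x 0) := by abel
      rw [hsplit]
      exact norm_add₃_le.trans
        (add_le_add_left (add_le_add (hh q hqP) (hg _ _)) _)
    have hstep : ‖x (q + 1) - x 0‖ ≤ ‖x q - x 0‖ + α * ‖h q‖ := by
      rw [hx q hqP, sub_right_comm]
      refine (norm_sub_le _ _).trans_eq ?_
      rw [norm_smul, Real.norm_of_nonneg hα]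
    calc M * ‖x (q + 1) - x 0‖
        ≤ M * (‖x q - x 0‖ + α * (δ + M * ‖x q - x 0‖ + ‖g (x 0)‖)) := by
          gcongr
          exact hstep.trans (by gcongr)
      _ = (1 + α * M) * (M * ‖x q - x 0‖) + α * M * (δ + ‖g (x 0)‖) := by ring
      _ ≤ (1 + α * M) * ((δ + ‖g (x 0)‖) * ((1 + α * M) ^ q - 1))
            + α * M * (δ + ‖g (x 0)‖) := by
          have hfactor : 0 ≤ 1 + α * M := by positivity
          exact add_le_add_left (mul_le_mul_of_nonneg_left (ih hqP.le) hfactor) _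
      _ = _ := by ring

theorem sum_range_id_sq_le (P : ℕ) :
    ∑ q ∈ Finset.range P, (q : ℝ) ≤ (P : ℝ) ^ 2 / 2 ∧
      ∑ q ∈ Finset.range P, (q : ℝ) ^ 2 ≤ (P : ℝ) ^ 3 / 3 := by
  induction P with
  | zero => simp
  | succ P ih =>
    have hP : (0 : ℝ) ≤ P := P.cast_nonneg
    rw [Finset.sum_range_succ, Finset.sum_range_succ]
    push_cast
    constructor <;> nlinarith [ih.1, ih.2]

/-- Cumulative squared drift of a perturbed gradient iteration over a horizon `P` with
`α * M * P ≤ 1 / 2`. -/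
theorem sum_norm_sq_drift_le {E : Type*} [NormedAddCommGroup E]
    [NormedSpace ℝ E] {g : E → E} {M α δ : ℝ} (hM : 0 ≤ M) (hα : 0 ≤ α) (hδ : 0 ≤ δ)
    (hg : ∀ x y, ‖g x - g y‖ ≤ M * ‖x - y‖) {x h : ℕ → E} {P : ℕ}
    (hh : ∀ q < P, ‖h q - g (x q)‖ ≤ δ) (hx : ∀ q < P, x (q + 1) = x q - α • h q)
    (hP : α * M * P ≤ 1 / 2) :
    ∑ q ∈ Finset.range P, ‖h q - g (x 0)‖ ^ 2 ≤
      P * (2 * δ ^ 2 + 24 * (α * M * P) ^ 2 * ‖g (x 0)‖ ^ 2) := by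
  set u := α * M
  set G := ‖g (x 0)‖
  have hu : 0 ≤ u := mul_nonneg hα hM
  have hG : 0 ≤ G := norm_nonneg _
  have hterm : ∀ q ∈ Finset.range P, ‖h q - g (x 0)‖ ^ 2 ≤
      32 / 31 * δ ^ 2 + 96 / 31 * δ ^ 2 * u * q
        + (72 / 31 * δ ^ 2 * u ^ 2 + 72 * G ^ 2 * u ^ 2) * (q : ℝ) ^ 2 := by
    intro q hq
    have hqP : q < P := Finset.mem_range.1 hq
    have hqu : q * u ≤ 1 / 2 := by
      have : (q : ℝ) ≤ P := by exact_mod_cast hqP.le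
      nlinarith
    have hdrift := mul_norm_sub_le_of_perturbed_step hM hα hg hh hx hqP.le
    have hpow := one_add_pow_le_of_mul_le_half hu hqu
    have hnorm : ‖h q - g (x 0)‖ ≤ δ * (1 + 3 / 2 * (q * u)) + G * (3 / 2 * (q * u)) := by
      calc ‖h q - g (x 0)‖ ≤ ‖h q - g (x q)‖ + ‖g (x q) - g (x 0)‖ :=
            norm_sub_le_norm_sub_add_norm_sub _ _ _
        _ ≤ δ + (δ + G) * ((1 + u) ^ q - 1) :=
            add_le_add (hh q hqP) ((hg _ _).trans hdrift)
        _ ≤ δ + (δ + G) * (3 / 2 * (q * u)) := by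
            gcongr
            linarith
        _ = _ := by ring
    refine (pow_le_pow_left₀ (norm_nonneg _) hnorm 2).trans ?_
    nlinarith [sq_nonneg (δ * (1 + 3 / 2 * (q * u)) - 31 * (G * (3 / 2 * (q * u))))]
  refine (Finset.sum_le_sum hterm).trans ?_
  rw [Finset.sum_add_distrib, Finset.sum_add_distrib, Finset.sum_const, Finset.card_range,
    nsmul_eq_mul, ← Finset.mul_sum, ← Finset.mul_sum]
  obtain ⟨hsum, hsum_sq⟩ := sum_range_id_sq_le P
  have huP : 0 ≤ u * P := by positivity
  calc _ ≤ P * (32 / 31 * δ ^ 2) + 96 / 31 * δ ^ 2 * u * ((P : ℝ) ^ 2 / 2)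
        + (72 / 31 * δ ^ 2 * u ^ 2 + 72 * G ^ 2 * u ^ 2) * ((P : ℝ) ^ 3 / 3) := by
        gcongr
    _ = P * (δ ^ 2 * (32 / 31 + 48 / 31 * (u * P) + 24 / 31 * (u * P) ^ 2)
          + 24 * (u * P) ^ 2 * G ^ 2) := by ring
    _ ≤ _ := by
        rw [mul_comm 2 (δ ^ 2)]
        gcongr
        nlinarith

/-- **Cumulative gradient drift** (Lemma 9).
Bounds the drift of `P` inexact local proximal-gradient iterations (each proximal
point computed to accuracy `ε`) from the Moreau-envelope gradients at the outer
iterate `K`, provided `η = αβP ≤ β / (2 L_lam)` with `L_lam = lam L / (lam - L)`. -/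
theorem stmt_9 {E : Type*} [NormedAddCommGroup E] [InnerProductSpace ℝ E]
    [FiniteDimensional ℝ E]
    (V P : ℕ) (hV : 1 ≤ V) (hP : 1 ≤ P)
    (f : Fin V → E → ℝ) (hf : ∀ i, Differentiable ℝ (f i))
    (L : ℝ)
    (hlip : ∀ i, ∀ x y : E, ‖gradient (f i) x - gradient (f i) y‖ ≤ L * ‖x - y‖)
    (lam : ℝ) (hlam : L < lam)
    (p : Fin V → E → E)
    (hp : ∀ i, ∀ x : E,
      IsMinOn (fun y : E => f i y + lam / 2 * ‖y - x‖ ^ 2) Set.univ (p i x))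
    (g : Fin V → E → E) (hg : ∀ i, ∀ x : E, g i x = lam • (x - p i x))
    (Llam : ℝ) (hLlam : Llam = lam * L / (lam - L))
    (K : E) (α β ε : ℝ) (hα : 0 < α) (hβ : 0 < β) (hε : 0 ≤ ε)
    (η : ℝ) (hη : η = α * β * P)
    (Kit : Fin V → ℕ → E) (Kbar : Fin V → ℕ → E)
    (hK0 : ∀ i, Kit i 0 = K)
    (hKbar : ∀ i, ∀ q < P, ‖Kbar i q - p i (Kit i q)‖ ≤ ε)
    (hrec : ∀ i, ∀ q < P,
      Kit i (q + 1) = Kit i q - (α * lam) • (Kit i q - Kbar i q))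
    (hstep : η ≤ β / (2 * Llam)) :
    (1 / (V * P) : ℝ) *
        ∑ i, ∑ q ∈ Finset.range P, ‖lam • (Kit i q - Kbar i q) - g i K‖ ^ 2 ≤
      2 * lam ^ 2 * ε ^ 2 +
        (16 * Llam ^ 2 * η ^ 2 / β ^ 2) *
          (2 * lam ^ 2 * ε ^ 2 / P + 3 * ((1 / V : ℝ) * ∑ i, ‖g i K‖ ^ 2)) := by
  have hV0 : (0 : ℝ) < V := by exact_mod_cast hV
  have hP0 : (0 : ℝ) < P := by exact_mod_cast hP
  rcases subsingleton_or_nontrivial E with hE | hE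
  · have hleft : ∀ i q, lam • (Kit i q - Kbar i q) - g i K = 0 :=
      fun i q => Subsingleton.elim _ _
    simp only [hleft, norm_zero, ne_eq, OfNat.ofNat_ne_zero, not_false_eq_true, zero_pow,
      Finset.sum_const_zero, mul_zero]
    positivity
  have hL : 0 ≤ L := by
    obtain ⟨x, y, hxy⟩ := exists_pair_ne E
    exact nonneg_of_mul_nonneg_left ((norm_nonneg _).trans (hlip ⟨0, hV⟩ x y))
      (norm_pos_iff.2 (sub_ne_zero.2 hxy))
  have hlam0 : 0 < lam := hL.trans_lt hlam
  have hη0 : 0 < η := by rw [hη]; positivity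
  have hLlam0 : 0 < Llam := by
    by_contra! hle
    exact (hη0.trans_le hstep).not_ge (div_nonpos_of_nonneg_of_nonpos hβ.le (by linarith))
  have hratio : Llam * η / β = α * Llam * P := by
    rw [hη]
    field_simp
  have hhorizon : α * Llam * P ≤ 1 / 2 := by
    rw [← hratio, div_le_iff₀ hβ]
    rw [le_div_iff₀ (by positivity)] at hstep
    linarith
  have hclient : ∀ i, ∑ q ∈ Finset.range P, ‖lam • (Kit i q - Kbar i q) - g i K‖ ^ 2 ≤
      P * (2 * (lam * ε) ^ 2 + 24 * (α * Llam * P) ^ 2 * ‖g i K‖ ^ 2) := by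
    intro i
    have hLip : ∀ x y, ‖g i x - g i y‖ ≤ Llam * ‖x - y‖ := fun x y => by
      rw [hg, hg, hLlam]
      exact norm_moreau_gradient_sub_le (hf i) hL hlam (hlip i) (hp i) x y
    have hacc : ∀ q < P, ‖lam • (Kit i q - Kbar i q) - g i (Kit i q)‖ ≤ lam * ε := by
      intro q hq
      rw [hg, ← smul_sub, sub_sub_sub_cancel_left, norm_smul, Real.norm_of_nonneg hlam0.le,
        norm_sub_rev]
      exact mul_le_mul_of_nonneg_left (hKbar i q hq) hlam0.le
    have hiter : ∀ q < P, Kit i (q + 1) = Kit i q - α • lam • (Kit i q - Kbar i q) :=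
      fun q hq => by rw [hrec i q hq, mul_smul]
    simpa only [hK0] using sum_norm_sq_drift_le hLlam0.le hα.le (by positivity) hLip hacc
      hiter hhorizon
  calc _ ≤ (1 / (V * P) : ℝ) *
        ∑ i, P * (2 * (lam * ε) ^ 2 + 24 * (α * Llam * P) ^ 2 * ‖g i K‖ ^ 2) := by
        gcongr with i
        exact hclient i
    _ = 2 * lam ^ 2 * ε ^ 2
          + 24 * (Llam * η / β) ^ 2 * ((1 / V : ℝ) * ∑ i, ‖g i K‖ ^ 2) := by
        rw [← Finset.mul_sum, Finset.sum_add_distrib, Finset.sum_const, Finset.card_univ,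
          Fintype.card_fin, nsmul_eq_mul, ← Finset.mul_sum, hratio]
        field_simp
    _ = 2 * lam ^ 2 * ε ^ 2 + (16 * Llam ^ 2 * η ^ 2 / β ^ 2) *
          (3 / 2 * ((1 / V : ℝ) * ∑ i, ‖g i K‖ ^ 2)) := by ring
    _ ≤ _ := by
        have hmean : 0 ≤ (1 / V : ℝ) * ∑ i, ‖g i K‖ ^ 2 := by positivity
        have herr : 0 ≤ 2 * lam ^ 2 * ε ^ 2 / P := by positivity
        gcongr
        linarith
end

section
/- Let E be a real finite-dimensional inner product space, let f : E → ℝ be differentiable with L-Lipschitz gradient and bounded below, let λ > L, and let p(x) denote the unique minimizer over E of y ↦ f(y) + (λ/2)‖y − x‖². Let 0 < α ≤ 1/λ and define the sequence K^0 := K, K^{j+1} := (1 − αλ)K^j + αλ·p(K^j) for j = 0, …, P − 1. If f(K) < ∞ is finite, then the Moreau envelope values decrease monotonically along the iterates: f_λ(K^{j+1}) ≤ f_λ(K^j) for all j, where f_λ(x) := f(p(x)) + (λ/2)‖p(x) − x‖²; in particular f_λ(K^P) ≤ f_λ(K^0) = f_λ(K), and f(p(K^j)) ≤ f_λ(K^j)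 ≤ f(K) for every j ≤ P once (i) holds, so all intermediate costs remain bounded by max(f(K), f_λ(K)) plus the envelope gap. -/
/-- **Monotone decrease and boundedness along the inner iterations**
(Proposition 10, boundedness part). For `f` `L`-smooth and bounded below, `lam > L`,
step size `0 < α ≤ 1 / lam`, and inner iterates
`K^{j+1} = (1 - α lam) K^j + α lam • p(K^j)` started at `K^0 = K0`, the Moreau
envelope values `f_lam(K^j) = f (p (K^j)) + (lam/2)‖p (K^j) - K^j‖²` decrease
monotonically, and `f (p (K^j)) ≤ f_lam (K^j) ≤ f K0` for every `j ≤ P`. -/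
theorem stmt_11 {E : Type*} [NormedAddCommGroup E] [InnerProductSpace ℝ E]
    [FiniteDimensional ℝ E]
    (f : E → ℝ) (hf : Differentiable ℝ f)
    (L : ℝ)
    (hlip : ∀ x y : E, ‖gradient f x - gradient f y‖ ≤ L * ‖x - y‖)
    (hbdd : BddBelow (Set.range f))
    (lam : ℝ) (hlam : L < lam)
    (p : E → E)
    (hp : ∀ x : E, IsMinOn (fun y : E => f y + lam / 2 * ‖y - x‖ ^ 2) Set.univ (p x))
    (flam : E → ℝ) (hflam : ∀ x : E, flam x = f (p x) + lam / 2 * ‖p x - x‖ ^ 2)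
    (α : ℝ) (hα : 0 < α) (hα' : α ≤ 1 / lam)
    (P : ℕ) (K0 : E) (Kseq : ℕ → E) (hK0 : Kseq 0 = K0)
    (hrec : ∀ j < P,
      Kseq (j + 1) = (1 - α * lam) • Kseq j + (α * lam) • p (Kseq j)) :
    (∀ j < P, flam (Kseq (j + 1)) ≤ flam (Kseq j)) ∧
      (∀ j ≤ P, f (p (Kseq j)) ≤ flam (Kseq j) ∧ flam (Kseq j) ≤ f K0) := by
  have hlam0 : 0 < lam := one_div_pos.mp (hα.trans_le hα')
  have hαlam : α * lam ≤ 1 := (le_div_iff₀ hlam0).mp hα'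
  have hαlam0 : 0 < α * lam := mul_pos hα hlam0
  have envelope_le : ∀ x y : E, flam x ≤ f y + lam / 2 * ‖y - x‖ ^ 2 := fun x y => by
    rw [hflam]
    exact hp x (Set.mem_univ y)
  have hmono : ∀ j < P, flam (Kseq (j + 1)) ≤ flam (Kseq j) := fun j hj => by
    have hdiff : p (Kseq j) - Kseq (j + 1) = (1 - α * lam) • (p (Kseq j) - Kseq j) := by
      rw [hrec j hj]
      module
    have hnorm : ‖p (Kseq j) - Kseq (j + 1)‖ ≤ ‖p (Kseq j) - Kseq j‖ := by
      rw [hdiff, norm_smul, Real.norm_of_nonneg (sub_nonneg.mpr hαlam)]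
      exact mul_le_of_le_one_left (norm_nonneg _) (by linarith)
    calc flam (Kseq (j + 1))
        ≤ f (p (Kseq j)) + lam / 2 * ‖p (Kseq j) - Kseq (j + 1)‖ ^ 2 := envelope_le _ _
      _ ≤ f (p (Kseq j)) + lam / 2 * ‖p (Kseq j) - Kseq j‖ ^ 2 := by gcongr
      _ = flam (Kseq j) := (hflam _).symm
  refine ⟨hmono, fun j hj => ⟨?_, ?_⟩⟩
  · rw [hflam]
    exact le_add_of_nonneg_right (by positivity)
  · induction j with
    | zero => simpa [hK0] using envelope_le K0 K0
    | succ j ih => exact (hmono j hj).trans (ih (Nat.le_of_succ_le hj))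
end
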